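/- arXiv:1401.4907 — 2 statements merged into one kernel-verified Lean document; each statement's English description precedes it below -/
import Mathlib

section
/- Let Θ = (α, ρ_r, ρ_d, ρ_s, ρ_0, T) be a parameter tuple with T > 1 and let R > 0 satisfy ρ_r + 2ρ_0 ≥ α/(1 + ⌊√T⌋) + (α(1 + ⌊√T⌋)/⌊√T⌋)·(2^(R/(1 − ⌊√T⌋/T)) − 1). Define e(R,Θ) := R/(2ρ_r + ρ_d + ρ_s + 4ρ_0 + (32/3)·ρ_0/T). Then (2/3)·e(R,Θ) < ζ*_zf(R,Θ) < e(R,Θ). -/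
open Real

/-- Uplink SINR-like quantity γ_u(M,K,τ,R,T). -/
noncomputable def gammaU (M K τ R T : ℝ) : ℝ :=
  ((K + τ) * ((2:ℝ) ^ (R / (K * (1 - τ / T))) - 1)) / (2 * τ * (M - K)) +
    Real.sqrt ((((K + τ) * ((2:ℝ) ^ (R / (K * (1 - τ / T))) - 1)) / (2 * τ * (M - K))) ^ 2 +
      ((2:ℝ) ^ (R / (K * (1 - τ / T))) - 1) / (τ * (M - K)))

/-- Total normalized power consumption P(M,K,τ,R,Θ). -/
noncomputable def Ptot (M K τ R α ρr ρd ρs ρ0 T : ℝ) : ℝ :=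
  α * K * gammaU M K τ R T + ρs + K * (ρd + (8/3) * K ^ 2 * ρ0 / T) +
    M * (ρr + 2 * K * ρ0 + 4 * K ^ 2 * ρ0 / T)

/-- Optimal normalized energy efficiency ζ*_zf(R,Θ) (integer optimization). -/
noncomputable def zetaZfStar (R α ρr ρd ρs ρ0 T : ℝ) : ℝ :=
  R / sInf {p : ℝ | ∃ M K τ : ℤ, 1 ≤ K ∧ K ≤ τ ∧ (τ : ℝ) < T ∧ K < M ∧
    p = Ptot (M : ℝ) (K : ℝ) (τ : ℝ) R α ρr ρd ρs ρ0 T}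

/-- Maximum number of users K_max(Θ). -/
noncomputable def Kmax (ρr ρd ρ0 T : ℝ) : ℝ :=
  min (T / 4) (min (ρr / (3 * ρ0)) (3 * ρd / (2 * ρ0)))

/-- The function g(x). -/
noncomputable def gfun (x : ℝ) : ℝ :=
  Real.sqrt (x / ((2:ℝ) ^ x - 1)) * ((2:ℝ) ^ x * x * Real.log 2 - (2:ℝ) ^ x + 1)

/-- Ideal (perfect CSI) power consumption P_csi(M,K,R,Θ). -/
noncomputable def Pcsi (M K R α ρr ρd ρs : ℝ) : ℝ :=
  α * K * ((2:ℝ) ^ (R / K) - 1) / (M - K) + M * ρr + K * ρd + ρs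

/-- Relaxed (real-valued) optimal EE ζ'_zf(R,Θ) with K ≤ K_max(Θ). -/
noncomputable def zetaZfPrime (R α ρr ρd ρs ρ0 T : ℝ) : ℝ :=
  R / sInf {p : ℝ | ∃ M K τ : ℝ, 1 ≤ K ∧ K ≤ Kmax ρr ρd ρ0 T ∧ K ≤ τ ∧ τ < T ∧ K < M ∧
    p = Ptot M K τ R α ρr ρd ρs ρ0 T}

/-- Optimal EE of the ideal perfect-CSI system ζ'_csi(R,Θ). -/
noncomputable def zetaCsiPrime (R α ρr ρd ρs ρ0 T : ℝ) : ℝ :=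
  R / sInf {p : ℝ | ∃ M K : ℝ, 1 ≤ K ∧ K ≤ Kmax ρr ρd ρ0 T ∧ K < M ∧
    p = Pcsi M K R α ρr ρd ρs}

/-- Relaxed optimal EE with the number of users fixed to K. -/
noncomputable def zetaZfFixedK (K R α ρr ρd ρs ρ0 T : ℝ) : ℝ :=
  R / sInf {p : ℝ | ∃ M τ : ℝ, K < M ∧ K ≤ τ ∧ τ < T ∧
    p = Ptot M K τ R α ρr ρd ρs ρ0 T}

/-- The rate exponent of a feasible point is at least `R / K`, so the SINR target is at least
`2 ^ (R / K) - 1`. -/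
theorem two_rpow_rate_le {K τ R T : ℝ} (hR : 0 ≤ R) (hK : 0 < K) (hτ : 0 ≤ τ) (hT : τ < T) :
    (2:ℝ) ^ (R / K) - 1 ≤ (2:ℝ) ^ (R / (K * (1 - τ / T))) - 1 := by
  have hT0 : 0 < T := hτ.trans_lt hT
  have h1 : τ / T < 1 := (div_lt_one hT0).2 hT
  have h2 : 0 ≤ τ / T := by positivity
  have h3 : 0 < 1 - τ / T := by linarith
  have h4 : R / K ≤ R / (K * (1 - τ / T)) := by
    apply div_le_div_of_nonneg_left hR (by positivity)
    nlinarith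
  have := Real.rpow_le_rpow_of_exponent_le (x := 2) (by norm_num) h4
  linarith

theorem two_rpow_sub_one_nonneg {x : ℝ} (hx : 0 ≤ x) : 0 ≤ (2:ℝ) ^ x - 1 :=
  sub_nonneg.2 (Real.one_le_rpow (by norm_num) hx)

theorem two_rpow_sub_one_pos {x : ℝ} (hx : 0 < x) : 0 < (2:ℝ) ^ x - 1 :=
  sub_pos.2 (Real.one_lt_rpow (by norm_num) hx)

theorem half_le_gammaU {M K τ R T : ℝ} (hR : 0 ≤ R) (hK : 0 < K) (hτ : 0 < τ) (hT : τ < T)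
    (hM : K < M) : ((2:ℝ) ^ (R / K) - 1) / (2 * (M - K)) ≤ gammaU M K τ R T := by
  have hE := two_rpow_rate_le hR hK hτ.le hT
  have hE0 := two_rpow_sub_one_nonneg (div_nonneg hR hK.le)
  unfold gammaU
  set E := (2:ℝ) ^ (R / (K * (1 - τ / T))) - 1
  have hMK : 0 < M - K := sub_pos.2 hM
  refine le_add_of_le_of_nonneg ?_ (Real.sqrt_nonneg _)
  rw [div_le_div_iff₀ (by positivity) (by positivity)]
  have h1 : ((2:ℝ) ^ (R / K) - 1) * τ ≤ (K + τ) * E := by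
    nlinarith [mul_nonneg hK.le (hE0.trans hE)]
  calc _ = ((2:ℝ) ^ (R / K) - 1) * τ * (2 * (M - K)) := by ring
    _ ≤ _ := by gcongr

theorem gammaU_nonneg {M K τ R T : ℝ} (hR : 0 ≤ R) (hK : 0 < K) (hτ : 0 < τ) (hT : τ < T)
    (hM : K < M) : 0 ≤ gammaU M K τ R T :=
  (div_nonneg (two_rpow_sub_one_nonneg (div_nonneg hR hK.le))
    (by linarith)).trans (half_le_gammaU hR hK hτ hT hM)

theorem gammaU_two_one_le {τ R T : ℝ} (hR : 0 < R) (hτ : 0 < τ) (hT : τ < T) :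
    gammaU 2 1 τ R T ≤ 1 / (1 + τ) + (1 + τ) / τ * ((2:ℝ) ^ (R / (1 - τ / T)) - 1) := by
  have hE : 0 < (2:ℝ) ^ (R / (1 - τ / T)) - 1 := by
    apply two_rpow_sub_one_pos
    have := (div_lt_one (hτ.trans hT)).2 hT
    exact div_pos hR (by linarith)
  unfold gammaU
  rw [one_mul]
  set E := (2:ℝ) ^ (R / (1 - τ / T)) - 1
  have h : √(((1 + τ) * E / (2 * τ * (2 - 1))) ^ 2 + E / (τ * (2 - 1))) ≤
      (1 + τ) * E / (2 * τ) + 1 / (1 + τ) := by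
    apply Real.sqrt_le_iff.2 ⟨by positivity, ?_⟩
    have : ((1 + τ) * E / (2 * τ) + 1 / (1 + τ)) ^ 2 =
        ((1 + τ) * E / (2 * τ * (2 - 1))) ^ 2 + E / (τ * (2 - 1)) + (1 / (1 + τ)) ^ 2 := by
      field_simp
      ring
    rw [this]
    exact le_add_of_nonneg_right (sq_nonneg _)
  have h2 : (1 + τ) * E / (2 * τ * (2 - 1)) + (1 + τ) * E / (2 * τ) = (1 + τ) / τ * E := by
    field_simp
    ring
  linarith

theorem Ptot_two_one (τ R α ρr ρd ρs ρ0 T : ℝ) :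
    Ptot 2 1 τ R α ρr ρd ρs ρ0 T =
      α * gammaU 2 1 τ R T + (2 * ρr + ρd + ρs + 4 * ρ0 + (32/3) * ρ0 / T) := by
  unfold Ptot
  ring

theorem add_le_Ptot_of_three_le {M K τ R α ρr ρd ρs ρ0 T : ℝ} (hR : 0 ≤ R) (hα : 0 ≤ α)
    (hρr : 0 ≤ ρr) (hρd : 0 ≤ ρd) (hρ0 : 0 ≤ ρ0) (hK : 1 ≤ K) (hτ : 0 < τ) (hT : τ < T)
    (hKM : K < M) (hM : 3 ≤ M) :
    ρr + (2 * ρr + ρd + ρs + 4 * ρ0 + (32/3) * ρ0 / T) ≤ Ptot M K τ R α ρr ρd ρs ρ0 T := by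
  have hT0 : 0 < T := hτ.trans hT
  have hγ : 0 ≤ α * K * gammaU M K τ R T :=
    mul_nonneg (by positivity) (gammaU_nonneg hR (by linarith) hτ hT hKM)
  have h1 : 1 * (ρd + (8/3) * 1 ^ 2 * ρ0 / T) ≤ K * (ρd + (8/3) * K ^ 2 * ρ0 / T) := by
    gcongr
  have h2 : 3 * (ρr + 2 * 1 * ρ0 + 4 * 1 ^ 2 * ρ0 / T) ≤
      M * (ρr + 2 * K * ρ0 + 4 * K ^ 2 * ρ0 / T) := by
    gcongr
  have h3 : 0 ≤ ρ0 / T := by positivity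
  unfold Ptot
  simp only [mul_div_assoc, one_pow, mul_one, one_mul] at h1 h2 h3 ⊢
  linarith

/-- tight bounds on ζ*_zf in the non-massive MIMO regime (Theorem 3). -/
theorem stmt_3 (R α ρr ρd ρs ρ0 T : ℝ)
    (hR : 0 < R) (hα : 1 < α) (hT : 1 < T)
    (hρr : 0 < ρr) (hρd : 0 < ρd) (hρs : 0 < ρs) (hρ0 : 0 < ρ0)
    (hcond : ρr + 2 * ρ0 ≥ α / (1 + (⌊Real.sqrt T⌋ : ℝ)) +
      α * (1 + (⌊Real.sqrt T⌋ : ℝ)) / (⌊Real.sqrt T⌋ : ℝ) *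
        ((2:ℝ) ^ (R / (1 - (⌊Real.sqrt T⌋ : ℝ) / T)) - 1)) :
    (2/3) * (R / (2 * ρr + ρd + ρs + 4 * ρ0 + (32/3) * ρ0 / T)) <
        zetaZfStar R α ρr ρd ρs ρ0 T ∧
      zetaZfStar R α ρr ρd ρs ρ0 T <
        R / (2 * ρr + ρd + ρs + 4 * ρ0 + (32/3) * ρ0 / T) := by
  have hT0 : 0 < T := by linarith
  have hs1 : 1 ≤ ⌊√T⌋ := Int.le_floor.2 (by simpa using Real.one_le_sqrt.2 hT.le)
  have hsT : (⌊√T⌋ : ℝ) < T := (Int.floor_le _).trans_lt ((Real.sqrt_lt' hT0).2 (by nlinarith))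
  have hs0 : (0:ℝ) < ⌊√T⌋ := by exact_mod_cast (by omega : 0 < ⌊√T⌋)
  set D := 2 * ρr + ρd + ρs + 4 * ρ0 + (32/3) * ρ0 / T with hD
  have hρT : 0 < (32/3) * ρ0 / T := by positivity
  have hD0 : 0 < D := by positivity
  have hE : 0 < (2:ℝ) ^ R - 1 := two_rpow_sub_one_pos hR
  obtain ⟨δ, hδ, hδr, hδE⟩ : ∃ δ > 0, δ ≤ ρr ∧ δ ≤ α * (((2:ℝ) ^ R - 1) / 2) :=
    ⟨min ρr (α * (((2:ℝ) ^ R - 1) / 2)), lt_min hρr (by positivity),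
      min_le_left _ _, min_le_right _ _⟩
  unfold zetaZfStar
  set S := {p : ℝ | ∃ M K τ : ℤ, 1 ≤ K ∧ K ≤ τ ∧ (τ : ℝ) < T ∧ K < M ∧
    p = Ptot (M : ℝ) (K : ℝ) (τ : ℝ) R α ρr ρd ρs ρ0 T}
  have hlow : ∀ p ∈ S, δ + D ≤ p := by
    rintro _ ⟨M, K, τ, hK, hKτ, hτT, hKM, rfl⟩
    have hτ : (0:ℝ) < τ := by exact_mod_cast (by omega : 0 < τ)
    rcases (by omega : 3 ≤ M ∨ (M = 2 ∧ K = 1)) with hM | ⟨rfl, rfl⟩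
    · have := add_le_Ptot_of_three_le (M := M) (K := K) (α := α) (ρs := ρs) hR.le (by linarith)
        hρr.le hρd.le hρ0.le (by exact_mod_cast hK) hτ hτT (by exact_mod_cast hKM)
        (by exact_mod_cast hM)
      linarith
    · push_cast
      rw [Ptot_two_one]
      have h := half_le_gammaU (M := 2) (K := 1) hR.le one_pos hτ hτT one_lt_two
      rw [div_one] at h
      norm_num only at h
      have := mul_le_mul_of_nonneg_left h (by linarith : 0 ≤ α)
      linarith
  have hmem : Ptot 2 1 (⌊√T⌋ : ℝ) R α ρr ρd ρs ρ0 T ∈ S :=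
    ⟨2, 1, ⌊√T⌋, le_rfl, hs1, hsT, by norm_num, by push_cast; rfl⟩
  have hinf : δ + D ≤ sInf S := le_csInf ⟨_, hmem⟩ hlow
  have hup : sInf S < 3 / 2 * D := by
    refine (csInf_le ⟨_, hlow⟩ hmem).trans_lt ?_
    rw [Ptot_two_one]
    have h := mul_le_mul_of_nonneg_left (gammaU_two_one_le hR hs0 hsT) (by linarith : 0 ≤ α)
    rw [mul_add, mul_one_div, ← mul_assoc, ← mul_div_assoc] at h
    linarith
  have hpos : 0 < sInf S := by linarith
  constructor
  · rw [← mul_div_assoc, div_lt_div_iff₀ hD0 hpos]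
    nlinarith
  · exact div_lt_div_of_pos_left hR hD0 (by linarith)
end

section
/- Let Θ = (α, ρ_r, ρ_d, ρ_s, ρ_0, T) be a parameter tuple with β := ρ_d/ρ_r, δ := ρ_s/ρ_r satisfying min(T/4, 1/(3·ρ_0/ρ_r), 3β/(2·ρ_0/ρ_r)) > 10, and let R > 0 satisfy (D.1) ρ_r > α/(2δ), (D.2) ρ_r > (3α/(4(1+β)²·R))·g(4R/(3·K_max(Θ)))², and (D.3) ρ_r < (α/(1+β)²)·g(R)²/R. Then 3/8 < ζ'_zf(R,Θ)/ζ'_csi(R,Θ) < 1. -/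
open Real

lemma mul_exp_sub_exp_nonneg {t : ℝ} : 0 ≤ t * exp t - (exp t - 1) := by
  have h := add_one_le_exp (-t)
  have h2 : exp t * exp (-t) = 1 := by rw [← exp_add]; simp
  nlinarith [exp_pos t]

lemma mul_exp_sub_exp_mono {s t : ℝ} (hs : 0 ≤ s) (hst : s ≤ t) :
    s * exp s - (exp s - 1) ≤ t * exp t - (exp t - 1) := by
  have h := add_one_le_exp (s - t)
  have h2 : exp t * exp (s - t) = exp s := by rw [← exp_add]; congr 1; ring
  have h3 : exp s ≤ exp t := exp_le_exp.2 hst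
  nlinarith [exp_pos t, mul_le_mul_of_nonneg_left h (exp_pos t).le]

lemma mul_exp_mul_exp_sub_one_le {s t : ℝ} (hs : 0 ≤ s) (hst : s ≤ t) :
    s * exp s * (exp t - 1) ≤ t * exp t * (exp s - 1) := by
  have h1 := add_one_le_exp (s - t)
  have h2 : exp t * exp (s - t) = exp s := by rw [← exp_add]; congr 1; ring
  have h3 := add_one_le_exp s
  have h4 : exp t * (s - t + 1) ≤ exp s := h2 ▸ mul_le_mul_of_nonneg_left h1 (exp_pos t).le
  nlinarith [exp_pos t, mul_le_mul_of_nonneg_left h4 hs,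
    mul_nonneg (mul_nonneg (sub_nonneg.2 hst) (exp_pos t).le) (sub_nonneg.2 h3)]

lemma one_lt_two_rpow {x : ℝ} (hx : 0 < x) : 1 < (2 : ℝ) ^ x :=
  one_lt_rpow (by norm_num) hx

lemma gfun_sq {x : ℝ} (hx : 0 < x) :
    gfun x ^ 2 = x / ((2 : ℝ) ^ x - 1) * ((2 : ℝ) ^ x * x * log 2 - (2 : ℝ) ^ x + 1) ^ 2 := by
  have := one_lt_two_rpow hx
  rw [gfun, mul_pow, sq_sqrt (div_nonneg hx.le (by linarith))]

lemma gfun_sq_mono {x y : ℝ} (hx : 0 < x) (hxy : x ≤ y) : gfun x ^ 2 ≤ gfun y ^ 2 := by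
  have hy := hx.trans_le hxy
  rw [gfun_sq hx, gfun_sq hy]
  have hl : 0 < log 2 := log_pos (by norm_num)
  have hfx := one_lt_two_rpow hx
  have hfy := one_lt_two_rpow hy
  have hst : log 2 * x ≤ log 2 * y := by gcongr
  have hs : 0 ≤ log 2 * x := by positivity
  have hw0 := mul_exp_sub_exp_nonneg (t := log 2 * x)
  have hw := mul_exp_sub_exp_mono hs hst
  have hsl := mul_exp_mul_exp_sub_one_le hs hst
  rw [rpow_def_of_pos two_pos] at hfx hfy ⊢
  rw [rpow_def_of_pos two_pos]
  set a := exp (log 2 * x)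
  set b := exp (log 2 * y)
  have ea : a * x * log 2 - a + 1 = log 2 * x * a - (a - 1) := by ring
  have eb : b * y * log 2 - b + 1 = log 2 * y * b - (b - 1) := by ring
  rw [ea, eb]
  set u := log 2 * x * a - (a - 1)
  set v := log 2 * y * b - (b - 1)
  have h1 : u / (a - 1) ≤ v / (b - 1) := by
    rw [div_le_div_iff₀ (by linarith) (by linarith)]
    simp only [u, v]
    nlinarith
  have h2 : x * u ≤ y * v := mul_le_mul hxy hw hw0 hy.le
  have h3 := mul_le_mul h1 h2 (mul_nonneg hx.le hw0)
    (div_nonneg (hw0.trans hw) (by linarith))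
  calc x / (a - 1) * u ^ 2 = u / (a - 1) * (x * u) := by ring
    _ ≤ v / (b - 1) * (y * v) := h3
    _ = _ := by ring

/-- `P_csi` minimized over the number of antennas, without the constant term. -/
noncomputable def csiCost (c d r K : ℝ) : ℝ :=
  2 * sqrt (c * (K * ((2 : ℝ) ^ (r / K) - 1))) + K * d

lemma hasDerivAt_csiCost {c d r K : ℝ} (hc : 0 < c) (hr : 0 < r) (hK : 0 < K) :
    HasDerivAt (csiCost c d r)
      (d - c * ((2 : ℝ) ^ (r / K) * (r / K) * log 2 - (2 : ℝ) ^ (r / K) + 1) /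
        sqrt (c * (K * ((2 : ℝ) ^ (r / K) - 1)))) K := by
  have hf := one_lt_two_rpow (div_pos hr hK)
  have hpos : 0 < c * (K * ((2 : ℝ) ^ (r / K) - 1)) :=
    mul_pos hc (mul_pos hK (by linarith))
  have hx : HasDerivAt (fun K : ℝ => r / K) (-r / K ^ 2) K := by
    have h := (hasDerivAt_const K r).div (hasDerivAt_id K) hK.ne'
    refine h.congr_deriv ?_
    simp
  have h1 := (((hasDerivAt_id K).mul
    ((hx.const_rpow (two_pos : (0 : ℝ) < 2)).sub_const 1)).const_mul c).sqrt hpos.ne'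
  have h2 := (h1.const_mul 2).add ((hasDerivAt_id K).mul_const d)
  refine h2.congr_deriv ?_
  have hs : sqrt (c * (K * ((2 : ℝ) ^ (r / K) - 1))) ≠ 0 := (sqrt_pos.2 hpos).ne'
  simp only [id, Pi.mul_apply] at hs ⊢
  field_simp
  ring

lemma csiCost_mono {c d r K₀ K : ℝ} (hc : 0 < c) (hd : 0 < d) (hr : 0 < r) (hK₀ : 0 < K₀)
    (hK : K₀ ≤ K) (h : c * gfun (r / K₀) ^ 2 ≤ d ^ 2 * r) :
    csiCost c d r K₀ ≤ csiCost c d r K := by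
  have hder : ∀ x ∈ Set.Ici K₀, HasDerivAt (csiCost c d r) _ x := fun x hx =>
    hasDerivAt_csiCost hc hr (hK₀.trans_le hx)
  refine monotoneOn_of_deriv_nonneg (convex_Ici K₀)
    (fun x hx => (hder x hx).continuousAt.continuousWithinAt)
    (fun x hx => (hder x (interior_subset hx)).differentiableAt.differentiableWithinAt)
    (fun x hx => ?_) Set.self_mem_Ici hK hK
  have hx' : K₀ ≤ x := interior_subset hx
  have hx0 := hK₀.trans_le hx'
  rw [(hder x hx').deriv]
  have hrx := div_pos hr hx0
  have hf := one_lt_two_rpow hrx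
  have hpos : 0 < c * (x * ((2 : ℝ) ^ (r / x) - 1)) :=
    mul_pos hc (mul_pos hx0 (by linarith))
  have hg := gfun_sq_mono hrx (div_le_div_of_nonneg_left hr.le hK₀ hx')
  have hg2 : c * gfun (r / x) ^ 2 ≤ d ^ 2 * r :=
    (mul_le_mul_of_nonneg_left hg hc.le).trans h
  rw [gfun_sq hrx] at hg2
  set f := (2 : ℝ) ^ (r / x)
  set w := f * (r / x) * log 2 - f + 1
  rw [sub_nonneg, div_le_iff₀ (sqrt_pos.2 hpos)]
  refine le_of_sq_le_sq ?_ (by positivity)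
  rw [mul_pow, mul_pow, sq_sqrt hpos.le]
  have hf1 : 0 < f - 1 := by linarith
  have e : c * (r / x / (f - 1) * w ^ 2) = c * w ^ 2 * r / (x * (f - 1)) := by
    field_simp
  rw [e, div_le_iff₀ (by positivity)] at hg2
  have hg3 : c * w ^ 2 ≤ d ^ 2 * (x * (f - 1)) := by
    refine le_of_mul_le_mul_right ?_ hr
    linarith
  nlinarith [mul_le_mul_of_nonneg_left hg3 hc.le]

lemma csiCost_le_Pcsi {M K R α ρr ρd ρs : ℝ} (hα : 0 < α) (hρr : 0 < ρr) (hK : 0 < K)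
    (hR : 0 < R) (hM : K < M) :
    csiCost (α * ρr) (ρr + ρd) R K + ρs ≤ Pcsi M K R α ρr ρd ρs := by
  have hf := one_lt_two_rpow (div_pos hR hK)
  have hm : 0 < M - K := sub_pos.2 hM
  rw [csiCost, Pcsi]
  set f := (2 : ℝ) ^ (R / K)
  have hu : 0 < K * (f - 1) := mul_pos hK (by linarith)
  have h : 2 * sqrt (α * ρr * (K * (f - 1))) ≤ α * K * (f - 1) / (M - K) + ρr * (M - K) := by
    have hA : 0 ≤ α * K * (f - 1) / (M - K) := by
      rw [mul_assoc]; positivity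
    have e : α * ρr * (K * (f - 1)) =
        (α * K * (f - 1) / (M - K)) * (ρr * (M - K)) := by
      field_simp
    rw [e, sqrt_mul hA]
    have h1 := sq_sqrt hA
    have h2 := sq_sqrt (mul_nonneg hρr.le hm.le)
    nlinarith [sq_nonneg (sqrt (α * K * (f - 1) / (M - K)) - sqrt (ρr * (M - K)))]
  linarith

lemma exists_Pcsi_eq_csiCost {K R α ρr ρd ρs : ℝ} (hα : 0 < α) (hρr : 0 < ρr) (hK : 0 < K)
    (hR : 0 < R) :
    ∃ M, K < M ∧ Pcsi M K R α ρr ρd ρs = csiCost (α * ρr) (ρr + ρd) R K + ρs := by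
  have hf := one_lt_two_rpow (div_pos hR hK)
  have hu : 0 < K * ((2 : ℝ) ^ (R / K) - 1) := mul_pos hK (by linarith)
  have hpos : 0 < α * ρr * (K * ((2 : ℝ) ^ (R / K) - 1)) := by positivity
  have hs := sqrt_pos.2 hpos
  refine ⟨K + sqrt (α * ρr * (K * ((2 : ℝ) ^ (R / K) - 1))) / ρr, ?_, ?_⟩
  · have := div_pos hs hρr
    linarith
  · rw [Pcsi, csiCost, add_sub_cancel_left]
    have h2 := sq_sqrt hpos.le
    set s := sqrt (α * ρr * (K * ((2 : ℝ) ^ (R / K) - 1)))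
    have e : α * K * ((2 : ℝ) ^ (R / K) - 1) / (s / ρr) = s := by
      rw [div_div_eq_mul_div, div_eq_iff hs.ne']
      linarith
    rw [e]
    field_simp
    ring

/-- Stretching antennas and users by `4/3` compensates for a rate increase by `4/3`. -/
lemma exists_Pcsi_stretch {M K R Kₘ α ρr ρd ρs : ℝ} (hα : 0 < α) (hρr : 0 < ρr) (hρd : 0 < ρd)
    (hR : 0 < R) (hK : 1 ≤ K) (hKₘ : 1 ≤ Kₘ) (hM : K < M)
    (h : α * ρr * gfun (4 * R / 3 / Kₘ) ^ 2 ≤ (ρr + ρd) ^ 2 * (4 * R / 3)) :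
    ∃ M' K', 1 ≤ K' ∧ K' ≤ Kₘ ∧ K' < M' ∧
      Pcsi M' K' (4 * R / 3) α ρr ρd ρs ≤ 4 / 3 * Pcsi M K R α ρr ρd ρs - ρs / 3 := by
  have e : Pcsi (4 / 3 * M) (4 / 3 * K) (4 * R / 3) α ρr ρd ρs ≤
      4 / 3 * Pcsi M K R α ρr ρd ρs - ρs / 3 := by
    have hf := one_lt_two_rpow (div_pos hR (by linarith : 0 < K))
    have hm : 0 < M - K := sub_pos.2 hM
    rw [Pcsi, Pcsi]
    have e1 : 4 * R / 3 / (4 / 3 * K) = R / K := by field_simp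
    have e2 : α * (4 / 3 * K) * ((2 : ℝ) ^ (R / K) - 1) / (4 / 3 * M - 4 / 3 * K) =
        α * K * ((2 : ℝ) ^ (R / K) - 1) / (M - K) := by
      rw [← mul_sub]; field_simp
    have : 0 ≤ α * K * ((2 : ℝ) ^ (R / K) - 1) / (M - K) :=
      div_nonneg (mul_nonneg (by positivity) (by linarith)) hm.le
    rw [e1, e2]
    linarith
  rcases le_or_gt (4 / 3 * K) Kₘ with hc | hc
  · exact ⟨4 / 3 * M, 4 / 3 * K, by linarith, hc, by linarith, e⟩
  · have hR' : 0 < 4 * R / 3 := by positivity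
    obtain ⟨M', hM', he⟩ := exists_Pcsi_eq_csiCost (ρd := ρd) (ρs := ρs) hα hρr
      (by linarith : 0 < Kₘ) hR'
    refine ⟨M', Kₘ, hKₘ, le_rfl, hM', ?_⟩
    have h1 := csiCost_mono (by positivity) (by positivity) hR' (by linarith) hc.le h
    have h2 := csiCost_le_Pcsi (ρd := ρd) (ρs := ρs) hα hρr (by linarith : 0 < 4 / 3 * K) hR'
      (by linarith : 4 / 3 * K < 4 / 3 * M)
    linarith

lemma Pcsi_add_le_Ptot {M K τ R α ρr ρd ρs ρ0 T : ℝ} (hα : 0 < α) (hρ0 : 0 < ρ0) (hT : 0 < T)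
    (hR : 0 < R) (hK : 1 ≤ K) (hτ : K ≤ τ) (hτT : τ < T) (hM : K < M) :
    Pcsi M K R α ρr ρd ρs + 2 * ρ0 ≤ Ptot M K τ R α ρr ρd ρs ρ0 T := by
  have hK0 : 0 < K := by linarith
  have hτ0 : 0 < τ := by linarith
  have hm : 0 < M - K := sub_pos.2 hM
  have hq : τ / T < 1 := (div_lt_one hT).2 hτT
  have hq0 : 0 < τ / T := by positivity
  have hf := one_lt_two_rpow (div_pos hR hK0)
  have hE : (2 : ℝ) ^ (R / K) ≤ (2 : ℝ) ^ (R / (K * (1 - τ / T))) := by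
    refine rpow_le_rpow_of_exponent_le (by norm_num) ?_
    refine div_le_div_of_nonneg_left hR.le (mul_pos hK0 (by linarith)) ?_
    nlinarith
  have hγ : ((2 : ℝ) ^ (R / K) - 1) / (M - K) ≤ gammaU M K τ R T := by
    rw [gammaU]
    set E := (2 : ℝ) ^ (R / (K * (1 - τ / T))) - 1
    have hE0 : 0 < E := by simp only [E]; linarith
    set A := ((K + τ) * E) / (2 * τ * (M - K)) with hA
    have hs : A ≤ sqrt (A ^ 2 + E / (τ * (M - K))) := by
      refine le_sqrt_of_sq_le ?_
      have : 0 ≤ E / (τ * (M - K)) := by positivity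
      linarith
    have h2 : E / (M - K) ≤ 2 * A := by
      have : 2 * A = E / (M - K) + K * E / (τ * (M - K)) := by
        rw [hA]; field_simp; ring
      have : 0 ≤ K * E / (τ * (M - K)) := by positivity
      linarith
    have h3 : ((2 : ℝ) ^ (R / K) - 1) / (M - K) ≤ E / (M - K) := by
      gcongr
      simp only [E]; linarith
    linarith
  rw [Pcsi, Ptot]
  have h1 : α * K * ((2 : ℝ) ^ (R / K) - 1) / (M - K) ≤ α * K * gammaU M K τ R T := by
    rw [mul_div_assoc]; gcongr
  have h2 : 0 ≤ K * ((8 / 3) * K ^ 2 * ρ0 / T) := by positivity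
  have hM0 : 0 < M := by linarith
  have h3 : 0 ≤ M * (4 * K ^ 2 * ρ0 / T) := by positivity
  have h4 : 1 ≤ M * K := by nlinarith
  nlinarith

lemma Ptot_le_two_mul_Pcsi {M K R α ρr ρd ρs ρ0 T : ℝ} (hα : 0 < α) (hρ0 : 0 < ρ0) (hT : 0 < T)
    (hR : 0 < R) (hK : 1 ≤ K) (hM : K < M) (hKT : K ≤ T / 4) (hKr : 3 * K * ρ0 ≤ ρr)
    (hKd : 2 * K * ρ0 ≤ 3 * ρd) (hs : α ≤ 2 * ρs) :
    Ptot M K (T / 4) R α ρr ρd ρs ρ0 T ≤ 2 * Pcsi M K (4 * R / 3) α ρr ρd ρs := by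
  have hK0 : 0 < K := by linarith
  have hM0 : 0 < M := by linarith
  have hm : 0 < M - K := sub_pos.2 hM
  have hx : R / (K * (1 - T / 4 / T)) = 4 * R / 3 / K := by
    field_simp; norm_num
  have hf := one_lt_two_rpow (div_pos (by positivity : 0 < 4 * R / 3) hK0)
  rw [Ptot, Pcsi, gammaU, hx]
  set E := (2 : ℝ) ^ (4 * R / 3 / K) - 1 with hEdef
  have hE0 : 0 < E := by simp only [E]; linarith
  obtain ⟨τ, rfl⟩ : ∃ τ, T = 4 * τ := ⟨T / 4, by ring⟩
  rw [mul_div_cancel_left₀ τ (by norm_num : (4 : ℝ) ≠ 0)] at hKT ⊢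
  have hτ : 0 < τ := by linarith
  set A := ((K + τ) * E) / (2 * τ * (M - K)) with hA
  have hA0 : 0 < A := by positivity
  have hsq : sqrt (A ^ 2 + E / (τ * (M - K))) ≤ A + 1 / (K + τ) := by
    refine sqrt_le_iff.2 ⟨by positivity, ?_⟩
    have e : E / (τ * (M - K)) = 2 * A * (1 / (K + τ)) := by
      rw [hA]; field_simp
    rw [e]
    nlinarith [sq_nonneg (1 / (K + τ))]
  have hA1 : A ≤ E / (M - K) := by
    rw [hA, div_le_div_iff₀ (by positivity) hm]
    have : 0 ≤ (τ - K) * (E * (M - K)) := mul_nonneg (by linarith) (by positivity)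
    linarith
  have hB : K * (1 / (K + τ)) ≤ 1 / 2 := by
    rw [mul_one_div, div_le_div_iff₀ (by positivity) (by norm_num)]
    linarith
  have h1 : α * K * (A + sqrt (A ^ 2 + E / (τ * (M - K)))) ≤
      2 * (α * K * E / (M - K)) + α / 2 := by
    calc α * K * (A + sqrt (A ^ 2 + E / (τ * (M - K))))
        ≤ α * K * (E / (M - K) + (E / (M - K) + 1 / (K + τ))) := by
          gcongr; linarith
      _ = 2 * (α * K * E / (M - K)) + α * (K * (1 / (K + τ))) := by ring
      _ ≤ 2 * (α * K * E / (M - K)) + α * (1 / 2) := by gcongr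
      _ = _ := by ring
  have hq : K ^ 2 * ρ0 / (4 * τ) ≤ K * ρ0 / 4 := by
    rw [div_le_div_iff₀ (by positivity) (by norm_num)]
    have : 0 ≤ K * ρ0 * (τ - K) := mul_nonneg (by positivity) (by linarith)
    linarith
  have h2 : K * (ρd + (8 / 3) * K ^ 2 * ρ0 / (4 * τ)) ≤ K * (2 * ρd) := by
    gcongr
    have e : (8 / 3) * K ^ 2 * ρ0 / (4 * τ) = (8 / 3) * (K ^ 2 * ρ0 / (4 * τ)) := by ring
    rw [e]
    linarith
  have h3 : M * (ρr + 2 * K * ρ0 + 4 * K ^ 2 * ρ0 / (4 * τ)) ≤ M * (2 * ρr) := by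
    gcongr
    have e : 4 * K ^ 2 * ρ0 / (4 * τ) = 4 * (K ^ 2 * ρ0 / (4 * τ)) := by ring
    rw [e]
    linarith
  linarith

lemma le_Pcsi {M K R α ρr ρd ρs : ℝ} (hα : 0 < α) (hρr : 0 < ρr) (hρd : 0 < ρd)
    (hR : 0 < R) (hK : 0 < K) (hM : K < M) :
    ρs ≤ Pcsi M K R α ρr ρd ρs := by
  have hf := one_lt_two_rpow (div_pos hR hK)
  have hm : 0 < M - K := sub_pos.2 hM
  have hM0 : 0 < M := hK.trans hM
  have : 0 ≤ α * K * ((2 : ℝ) ^ (R / K) - 1) / (M - K) :=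
    div_nonneg (mul_nonneg (by positivity) (by linarith)) hm.le
  have := mul_pos hM0 hρr
  have := mul_pos hK hρd
  rw [Pcsi]
  linarith

/-- 3/8 < ζ'_zf(R,Θ)/ζ'_csi(R,Θ) < 1 (Theorem 4). -/
theorem stmt_14 (α ρr ρd ρs ρ0 T R : ℝ)
    (hα : 1 < α) (hρr : 0 < ρr) (hρd : 0 < ρd) (hρs : 0 < ρs) (hρ0 : 0 < ρ0) (hT : 1 < T)
    (hcond : 10 < min (T / 4)
      (min (1 / (3 * (ρ0 / ρr))) (3 * (ρd / ρr) / (2 * (ρ0 / ρr)))))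
    (hR : 0 < R)
    (hD1 : ρr > α / (2 * (ρs / ρr)))
    (hD2 : ρr > 3 * α / (4 * (1 + ρd / ρr) ^ 2 * R) *
      (gfun (4 * R / (3 * Kmax ρr ρd ρ0 T))) ^ 2)
    (hD3 : ρr < α / (1 + ρd / ρr) ^ 2 * (gfun R) ^ 2 / R) :
    3/8 < zetaZfPrime R α ρr ρd ρs ρ0 T / zetaCsiPrime R α ρr ρd ρs ρ0 T ∧
      zetaZfPrime R α ρr ρd ρs ρ0 T / zetaCsiPrime R α ρr ρd ρs ρ0 T < 1 := by
  have hα0 : 0 < α := by linarith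
  have hT0 : 0 < T := by linarith
  have e1 : 1 / (3 * (ρ0 / ρr)) = ρr / (3 * ρ0) := by field_simp
  have e2 : 3 * (ρd / ρr) / (2 * (ρ0 / ρr)) = 3 * ρd / (2 * ρ0) := by field_simp
  rw [e1, e2] at hcond
  change 10 < Kmax ρr ρd ρ0 T at hcond
  have hbounds : ∀ K, K ≤ Kmax ρr ρd ρ0 T →
      K ≤ T / 4 ∧ 3 * K * ρ0 ≤ ρr ∧ 2 * K * ρ0 ≤ 3 * ρd := by
    intro K hK
    rw [Kmax, le_min_iff, le_min_iff, le_div_iff₀ (by positivity : 0 < 3 * ρ0),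
      le_div_iff₀ (by positivity : 0 < 2 * ρ0)] at hK
    exact ⟨hK.1, by linarith [hK.2.1], by linarith [hK.2.2]⟩
  rw [zetaZfPrime, zetaCsiPrime]
  set Kₘ := Kmax ρr ρd ρ0 T
  have hs : α ≤ 2 * ρs := by
    rw [gt_iff_lt, div_lt_iff₀ (by positivity)] at hD1
    have : ρr * (2 * (ρs / ρr)) = 2 * ρs := by field_simp
    linarith
  have hg : α * ρr * gfun (4 * R / 3 / Kₘ) ^ 2 ≤ (ρr + ρd) ^ 2 * (4 * R / 3) := by
    rw [div_div]
    set G := gfun (4 * R / (3 * Kₘ)) ^ 2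
    have e : 3 * α / (4 * (1 + ρd / ρr) ^ 2 * R) * G =
        3 * α * ρr ^ 2 * G / (4 * (ρr + ρd) ^ 2 * R) := by
      field_simp
    rw [e, gt_iff_lt, div_lt_iff₀ (by positivity)] at hD2
    refine le_of_mul_le_mul_left ?_ hρr
    linarith
  set Z := {p : ℝ | ∃ M K τ : ℝ, 1 ≤ K ∧ K ≤ Kₘ ∧ K ≤ τ ∧ τ < T ∧ K < M ∧
    p = Ptot M K τ R α ρr ρd ρs ρ0 T}
  set C := {p : ℝ | ∃ M K : ℝ, 1 ≤ K ∧ K ≤ Kₘ ∧ K < M ∧ p = Pcsi M K R α ρr ρd ρs}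
  have hCne : C.Nonempty := ⟨_, 2, 1, le_rfl, by linarith, by norm_num, rfl⟩
  have hClb : ∀ p ∈ C, ρs ≤ p := by
    rintro p ⟨M, K, hK, -, hM, rfl⟩
    exact le_Pcsi hα0 hρr hρd hR (by linarith) hM
  have hCbdd : BddBelow C := ⟨ρs, hClb⟩
  have hZlb : ∀ p ∈ Z, sInf C + 2 * ρ0 ≤ p := by
    rintro p ⟨M, K, τ, hK, hKm, hτ, hτT, hM, rfl⟩
    have h1 := Pcsi_add_le_Ptot (ρr := ρr) (ρd := ρd) (ρs := ρs) hα0 hρ0 hT0 hR hK hτ hτT hM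
    have h2 : sInf C ≤ Pcsi M K R α ρr ρd ρs := csInf_le hCbdd ⟨M, K, hK, hKm, hM, rfl⟩
    linarith
  have hZbdd : BddBelow Z := ⟨_, hZlb⟩
  have hZle : ∀ p ∈ C, sInf Z ≤ 8 / 3 * p - 2 * ρs / 3 := by
    rintro p ⟨M, K, hK, hKm, hM, rfl⟩
    obtain ⟨M', K', hK', hKm', hM', hle⟩ := exists_Pcsi_stretch (ρs := ρs) hα0 hρr hρd hR hK
      (by linarith : 1 ≤ Kₘ) hM hg
    obtain ⟨b1, b2, b3⟩ := hbounds K' hKm'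
    have h1 := Ptot_le_two_mul_Pcsi hα0 hρ0 hT0 hR hK' hM' b1 b2 b3 hs
    have h2 : sInf Z ≤ Ptot M' K' (T / 4) R α ρr ρd ρs ρ0 T :=
      csInf_le hZbdd ⟨M', K', T / 4, hK', hKm', b1, by linarith, hM', rfl⟩
    linarith
  have hZne : Z.Nonempty := by
    obtain ⟨b1, -, -⟩ := hbounds 1 (by linarith)
    exact ⟨_, 2, 1, T / 4, le_rfl, by linarith, b1, by linarith, by norm_num, rfl⟩
  have hC : ρs ≤ sInf C := le_csInf hCne hClb
  have hCZ : sInf C + 2 * ρ0 ≤ sInf Z := le_csInf hZne hZlb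
  have hZC : 3 / 8 * (sInf Z + 2 * ρs / 3) ≤ sInf C :=
    le_csInf hCne fun p hp => by linarith [hZle p hp]
  have hC0 : 0 < sInf C := by linarith
  have hZ0 : 0 < sInf Z := by linarith
  have e : R / sInf Z / (R / sInf C) = sInf C / sInf Z := by field_simp
  rw [e, lt_div_iff₀ hZ0, div_lt_one hZ0]
  constructor <;> linarith
end
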